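/- arXiv:1812.04844 — 3 statements merged into one kernel-verified Lean document; each statement's English description precedes it below -/
import Mathlib

section
/- Let τ > 0 and z₀, z_τ ∈ ℝ. The function ẑ(s) = z₀ + z_τ e^{−τ s} satisfies Re ẑ(s) ≥ 0 for all s ∈ ℂ with Re s > 0 if and only if z₀ ≥ |z_τ|. (Consequently, ẑ is positive-real if and only if z₀ ≥ |z_τ|, since ẑ is entire and real on (0,∞).) -/
theorem delay_impedance_re (τ z₀ zτ : ℝ) (s : ℂ) :
    ((z₀ : ℂ) + (zτ : ℂ) * Complex.exp (-((τ : ℂ) * s))).re =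
      z₀ + zτ * (Real.exp (-(τ * s.re)) * Real.cos (τ * s.im)) := by
  simp [Complex.exp_re]

theorem nonneg_of_forall_delay_nonneg {τ a b : ℝ}
    (h : ∀ x : ℝ, 0 < x → 0 ≤ a + b * Real.exp (-(τ * x))) : 0 ≤ a + b := by
  have hcont : Continuous fun x : ℝ => a + b * Real.exp (-(τ * x)) := by fun_prop
  have hlim : Filter.Tendsto (fun x : ℝ => a + b * Real.exp (-(τ * x)))
      (nhdsWithin 0 (Set.Ioi 0)) (nhds (a + b)) := by
    simpa using (hcont.tendsto 0).mono_left nhdsWithin_le_nhds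
  refine ge_of_tendsto hlim ?_
  filter_upwards [self_mem_nhdsWithin] with x hx using h x hx

theorem delay_impedance_re_nonneg_iff (τ z₀ zτ : ℝ) (hτ : 0 < τ) :
    (∀ s : ℂ, 0 < s.re →
      0 ≤ ((z₀ : ℂ) + (zτ : ℂ) * Complex.exp (-((τ : ℂ) * s))).re) ↔ |zτ| ≤ z₀ := by
  simp only [delay_impedance_re]
  constructor
  · intro h
    have hpos : 0 ≤ z₀ + zτ := nonneg_of_forall_delay_nonneg (τ := τ) fun x hx => by
      simpa using h ⟨x, 0⟩ hx
    have hneg : 0 ≤ z₀ + -zτ := nonneg_of_forall_delay_nonneg (τ := τ) fun x hx => by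
      simpa [mul_div_cancel₀ Real.pi hτ.ne'] using h ⟨x, Real.pi / τ⟩ hx
    exact abs_le.2 ⟨by linarith, by linarith⟩
  · intro h s hs
    have hexp : Real.exp (-(τ * s.re)) ≤ 1 := Real.exp_le_one_iff.2 (by nlinarith)
    have hbound : |zτ * (Real.exp (-(τ * s.re)) * Real.cos (τ * s.im))| ≤ |zτ| := by
      rw [abs_mul, abs_mul, Real.abs_exp]
      exact mul_le_of_le_one_right (abs_nonneg _)
        (mul_le_one₀ hexp (abs_nonneg _) (Real.abs_cos_le_one _))
    linarith [neg_abs_le (zτ * (Real.exp (-(τ * s.re)) * Real.cos (τ * s.im)))]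

/-- The delay impedance `ẑ(s) = z₀ + z_τ e^{−τs}` (with `τ > 0`, `z₀, z_τ ∈ ℝ`) has
nonnegative real part on the open right half-plane if and only if `z₀ ≥ |z_τ|`.
Consequently, since `ẑ` is entire (in particular analytic on the right half-plane) and real
on `(0,∞)`, `ẑ` is positive-real if and only if `z₀ ≥ |z_τ|`. -/
theorem delay_impedance_positive_real_iff
    (τ z₀ zτ : ℝ) (hτ : 0 < τ) :
    ((∀ s : ℂ, 0 < s.re →
        0 ≤ ((z₀ : ℂ) + (zτ : ℂ) * Complex.exp (-((τ : ℂ) * s))).re) ↔ |zτ| ≤ z₀) ∧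
    ((DifferentiableOn ℂ (fun s : ℂ => (z₀ : ℂ) + (zτ : ℂ) * Complex.exp (-((τ : ℂ) * s)))
        {s : ℂ | 0 < s.re} ∧
      (∀ x : ℝ, 0 < x →
        ((z₀ : ℂ) + (zτ : ℂ) * Complex.exp (-((τ : ℂ) * (x : ℂ)))).im = 0) ∧
      (∀ s : ℂ, 0 < s.re →
        0 ≤ ((z₀ : ℂ) + (zτ : ℂ) * Complex.exp (-((τ : ℂ) * s))).re)) ↔ |zτ| ≤ z₀) := by
  refine ⟨delay_impedance_re_nonneg_iff τ z₀ zτ hτ,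
    fun h => (delay_impedance_re_nonneg_iff τ z₀ zτ hτ).1 h.2.2,
    fun h => ⟨by fun_prop, fun x _ => ?_, (delay_impedance_re_nonneg_iff τ z₀ zτ hτ).2 h⟩⟩
  simp [Complex.exp_im]
end

section
/- Let μ be a positive Radon measure on (0,∞) satisfying ∫₀^∞ dμ(ξ)/(1+ξ) < ∞ and ∫₀^∞ (1/ξ) dμ(ξ) = ∞. If u ∈ ℂ and φ : (0,∞) → ℂ is measurable with ∫₀^∞ |φ(ξ)|² ξ dμ(ξ) < ∞ and −ξ φ(ξ) = u for μ-a.e. ξ ∈ (0,∞), then u = 0 and φ = 0 μ-a.e.; that is, the ranges of the multiplication operator A φ = −ξ φ (with domain V₀) and of the control operator B u = (ξ ↦ u) intersect only in {0}. -/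
open MeasureTheory
open scoped ENNReal

/-- Lemma 5.2 of the paper: let `μ` be a positive Radon measure on `(0,∞)` with
`∫ dμ(ξ)/(1+ξ) < ∞` and `∫ (1/ξ) dμ(ξ) = ∞`. If `u ∈ ℂ` and `φ ∈ V₀`
(i.e. `∫ |φ(ξ)|² ξ dμ(ξ) < ∞`) satisfy `−ξ φ(ξ) = u` for `μ`-a.e. `ξ ∈ (0,∞)`, then
`u = 0` and `φ = 0` `μ`-a.e.: the ranges of `A` (with domain `V₀`) and `B` intersect
only in `{0}`. -/
theorem range_A_inter_range_B_trivial
    (μ : Measure ℝ)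
    (hRadon : ∀ K : Set ℝ, K ⊆ Set.Ioi 0 → IsCompact K → μ K < ⊤)
    (hμ : ∫⁻ ξ in Set.Ioi 0, ENNReal.ofReal (1 / (1 + ξ)) ∂μ < ⊤)
    (hμinf : ∫⁻ ξ in Set.Ioi 0, ENNReal.ofReal (1 / ξ) ∂μ = ⊤)
    (u : ℂ) (φ : ℝ → ℂ)
    (hφ : ∫⁻ ξ in Set.Ioi 0, (‖φ ξ‖₊ : ℝ≥0∞) ^ 2 * ENNReal.ofReal ξ ∂μ < ⊤)
    (heq : ∀ᵐ (ξ : ℝ) ∂(μ.restrict (Set.Ioi 0)), -(ξ : ℂ) * φ ξ = u) :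
    u = 0 ∧ (∀ᵐ ξ ∂(μ.restrict (Set.Ioi 0)), φ ξ = 0) := by
  have hpos : ∀ᵐ ξ ∂(μ.restrict (Set.Ioi 0)), (0 : ℝ) < ξ :=
    ae_restrict_mem measurableSet_Ioi
  have hu : u = 0 := by
    by_contra hu
    have key : ∫⁻ ξ in Set.Ioi 0, (‖φ ξ‖₊ : ℝ≥0∞) ^ 2 * ENNReal.ofReal ξ ∂μ
        = ∫⁻ ξ in Set.Ioi 0, ENNReal.ofReal (‖u‖ ^ 2) * ENNReal.ofReal (1 / ξ) ∂μ := by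
      refine lintegral_congr_ae ?_
      filter_upwards [heq, hpos] with ξ h hξ
      have hn : ‖u‖ = ξ * ‖φ ξ‖ := by
        rw [← h, norm_mul, norm_neg, Complex.norm_real, Real.norm_of_nonneg hξ.le]
      have hc : (‖φ ξ‖₊ : ℝ≥0∞) = ENNReal.ofReal ‖φ ξ‖ := (ofReal_norm _).symm
      rw [hc, ← ENNReal.ofReal_pow (norm_nonneg _), ← ENNReal.ofReal_mul (by positivity),
        ← ENNReal.ofReal_mul (by positivity), hn]
      congr 1
      field_simp
    rw [key, lintegral_const_mul' _ _ ENNReal.ofReal_ne_top, hμinf, ENNReal.mul_top] at hφ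
    · exact lt_irrefl _ hφ
    · have : 0 < ‖u‖ := norm_pos_iff.mpr hu
      exact (ENNReal.ofReal_pos.mpr (by positivity)).ne'
  refine ⟨hu, ?_⟩
  filter_upwards [heq, hpos] with ξ h hξ
  simpa [hu, hξ.ne'] using h
end

section
/- Let μ be a positive Radon measure on (0,∞) with ∫₀^∞ dμ(ξ)/(1+ξ) < ∞. Let u ∈ ℂ and let φ : (0,∞) → ℂ be measurable with ∫₀^∞ |φ(ξ)|² ξ dμ(ξ) < ∞, and suppose g(ξ) := −ξ φ(ξ) + u satisfies ∫₀^∞ |g(ξ)|² (1+ξ) dμ(ξ) < ∞. Then all integrals below converge and Re[ ∫₀^∞ g(ξ) conj(φ(ξ)) ξ dμ(ξ) − u · conj( ∫₀^∞ g(ξ) dμ(ξ) ) ] = − ∫₀^∞ |g(ξ)|² dμ(ξ) ≤ 0. (Passivity of the extended diffusive realization.) -/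
open MeasureTheory
open scoped ENNReal ComplexConjugate

/-- Passivity of the extended diffusive realization (Lemma 5.4(iv)): for a positive Radon
measure `μ` on `(0,∞)` with `∫ dμ(ξ)/(1+ξ) < ∞`, `u ∈ ℂ` and `φ ∈ V₀`
(i.e. `∫ |φ(ξ)|² ξ dμ(ξ) < ∞`) such that `g(ξ) = −ξφ(ξ)+u` satisfies
`∫ |g(ξ)|²(1+ξ) dμ(ξ) < ∞`, all the integrals below converge and
`Re[∫ g(ξ) conj(φ(ξ)) ξ dμ(ξ) − u · conj(∫ g(ξ) dμ(ξ))] = −∫ |g(ξ)|² dμ(ξ) ≤ 0`. -/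
theorem extended_diffusive_passivity
    (μ : Measure ℝ)
    (hRadon : ∀ K : Set ℝ, K ⊆ Set.Ioi 0 → IsCompact K → μ K < ⊤)
    (hμ : ∫⁻ ξ in Set.Ioi 0, ENNReal.ofReal (1 / (1 + ξ)) ∂μ < ⊤)
    (u : ℂ) (φ : ℝ → ℂ) (hφm : Measurable φ)
    (hφ : ∫⁻ ξ in Set.Ioi 0, (‖φ ξ‖₊ : ℝ≥0∞) ^ 2 * ENNReal.ofReal ξ ∂μ < ⊤)
    (g : ℝ → ℂ) (hg : ∀ ξ : ℝ, g ξ = -(ξ : ℂ) * φ ξ + u)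
    (hgV1 : ∫⁻ ξ in Set.Ioi 0, (‖g ξ‖₊ : ℝ≥0∞) ^ 2 * ENNReal.ofReal (1 + ξ) ∂μ < ⊤) :
    IntegrableOn (fun ξ : ℝ => g ξ * conj (φ ξ) * (ξ : ℂ)) (Set.Ioi 0) μ ∧
    IntegrableOn g (Set.Ioi 0) μ ∧
    IntegrableOn (fun ξ : ℝ => ‖g ξ‖ ^ 2) (Set.Ioi 0) μ ∧
    ((∫ ξ in Set.Ioi 0, g ξ * conj (φ ξ) * (ξ : ℂ) ∂μ) -
        u * conj (∫ ξ in Set.Ioi 0, g ξ ∂μ)).re =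
      -(∫ ξ in Set.Ioi 0, ‖g ξ‖ ^ 2 ∂μ) ∧
    -(∫ ξ in Set.Ioi 0, ‖g ξ‖ ^ 2 ∂μ) ≤ 0 := by
  have hgm : Measurable g := by
    rw [funext hg]
    fun_prop
  have hweight : IntegrableOn (fun ξ : ℝ => 1 / (1 + ξ)) (Set.Ioi 0) μ := by
    refine ⟨(by fun_prop : Measurable fun ξ : ℝ => 1 / (1 + ξ)).aestronglyMeasurable, ?_⟩
    rw [hasFiniteIntegral_iff_ofReal]
    · exact hμ
    · filter_upwards [ae_restrict_mem measurableSet_Ioi] with ξ hξ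
      have : (0 : ℝ) < ξ := hξ
      simp only [Pi.zero_apply]
      positivity
  have hgw : IntegrableOn (fun ξ : ℝ => ‖g ξ‖ ^ 2 * (1 + ξ)) (Set.Ioi 0) μ := by
    refine ⟨by fun_prop, ?_⟩
    rw [hasFiniteIntegral_iff_ofReal]
    · convert hgV1 using 3 with ξ
      rw [ENNReal.ofReal_mul (by positivity), ENNReal.ofReal_pow (norm_nonneg _),
        ofReal_norm, enorm_eq_nnnorm]
    · filter_upwards [ae_restrict_mem measurableSet_Ioi] with ξ hξ
      have : (0 : ℝ) < ξ := hξ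
      simp only [Pi.zero_apply]
      positivity
  have hg2 : IntegrableOn (fun ξ : ℝ => ‖g ξ‖ ^ 2) (Set.Ioi 0) μ := by
    refine hgw.mono' (by fun_prop) ?_
    filter_upwards [ae_restrict_mem measurableSet_Ioi] with ξ hξ
    have : (0 : ℝ) < ξ := hξ
    rw [Real.norm_of_nonneg (by positivity)]
    nlinarith [mul_nonneg (sq_nonneg ‖g ξ‖) this.le]
  have hg1 : IntegrableOn g (Set.Ioi 0) μ := by
    refine (hgw.add hweight).mono' (by fun_prop) ?_
    filter_upwards [ae_restrict_mem measurableSet_Ioi] with ξ hξ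
    have h0 : (0 : ℝ) < 1 + ξ := add_pos one_pos hξ
    have hsq : 0 ≤ (‖g ξ‖ * (1 + ξ) - 1) ^ 2 / (1 + ξ) := by positivity
    have hexp : (‖g ξ‖ * (1 + ξ) - 1) ^ 2 / (1 + ξ)
        = ‖g ξ‖ ^ 2 * (1 + ξ) + 1 / (1 + ξ) - 2 * ‖g ξ‖ := by
      field_simp
      ring
    simp only [Pi.add_apply]
    linarith [norm_nonneg (g ξ)]
  have heq : (fun ξ : ℝ => g ξ * conj (φ ξ) * (ξ : ℂ)) =
      fun ξ : ℝ => conj u * g ξ - ((‖g ξ‖ ^ 2 : ℝ) : ℂ) := by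
    funext ξ
    have hconj : conj (φ ξ) * (ξ : ℂ) = conj u - conj (g ξ) := by
      rw [hg ξ]
      simp only [map_add, map_mul, map_neg, Complex.conj_ofReal]
      ring
    rw [mul_assoc, hconj, mul_sub, Complex.mul_conj']
    push_cast
    ring
  have hug : IntegrableOn (fun ξ : ℝ => conj u * g ξ) (Set.Ioi 0) μ := hg1.const_mul _
  have hg2c : IntegrableOn (fun ξ : ℝ => ((‖g ξ‖ ^ 2 : ℝ) : ℂ)) (Set.Ioi 0) μ := hg2.ofReal
  refine ⟨heq ▸ hug.sub hg2c, hg1, hg2, ?_, neg_nonpos.mpr (by positivity)⟩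
  rw [heq, integral_sub hug hg2c, integral_const_mul, integral_complex_ofReal]
  simp only [Complex.sub_re, Complex.mul_re, Complex.conj_re,
    Complex.conj_im, Complex.ofReal_re]
  ring
end
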